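/- Let X be a real reflexive Banach space, C ⊆ X a nonempty, non-singleton, closed convex set, and φ : X → ℝ locally Lipschitz. Then for each x ∈ C the infimum defining m_C(x) is attained at some x* ∈ ∂φ(x), and the function x ↦ m_C(x) is lower semicontinuous on C with respect to the norm topology. (Fact from [14] used in the proofs of Lemma 2.3 and Lemma 3.2) -/

import Mathlib

open Filter Topology Set

noncomputable section

variable {X : Type*} [NormedAddCommGroup X] [NormedSpace ℝ X]

/-- Clarke generalized directional derivative of a locally Lipschitz functional. -/
def clarkeDeriv (φ : X → ℝ) (x h : X) : ℝ :=
  Filter.limsup (fun p : X × ℝ => (φ (p.1 + p.2 • h) - φ p.1) / p.2)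
    ((𝓝 x) ×ˢ (𝓝[>] (0 : ℝ)))

/-- Clarke subdifferential. -/
def clarkeSubdiff (φ : X → ℝ) (x : X) : Set (X →L[ℝ] ℝ) :=
  {xs | ∀ h : X, xs h ≤ clarkeDeriv φ x h}

/-- `m(x) = inf {‖x*‖ : x* ∈ ∂φ(x)}`. -/
def mSlope (φ : X → ℝ) (x : X) : ℝ :=
  sInf {r | ∃ xs ∈ clarkeSubdiff φ x, r = ‖xs‖}

/-- `m_C(x)`. -/
def mCSlope (φ : X → ℝ) (C : Set X) (x : X) : ℝ :=
  sInf {r | ∃ xs ∈ clarkeSubdiff φ x,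
    r = sSup {s | ∃ y ∈ C, ‖x - y‖ < 1 ∧ s = xs (x - y)}}

/-- the nonsmooth (CPS)-condition on the whole space. -/
def CPS (φ : X → ℝ) : Prop :=
  ∀ x : ℕ → X, (∃ M : ℝ, ∀ n, |φ (x n)| ≤ M) →
    Tendsto (fun n => (1 + ‖x n‖) * mSlope φ (x n)) atTop (𝓝 0) →
    ∃ z : X, ∃ s : ℕ → ℕ, StrictMono s ∧ Tendsto (fun n => x (s n)) atTop (𝓝 z)

/-- the nonsmooth (CPS)_D-condition on a set D. -/
def CPSOn (φ : X → ℝ) (D : Set X) : Prop :=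
  ∀ x : ℕ → X, (∀ n, x n ∈ D) → (∃ M : ℝ, ∀ n, |φ (x n)| ≤ M) →
    Tendsto (fun n => (1 + ‖x n‖) * mCSlope φ D (x n)) atTop (𝓝 0) →
    ∃ z : X, ∃ s : ℕ → ℕ, StrictMono s ∧ Tendsto (fun n => x (s n)) atTop (𝓝 z)

/-- the (PS)-condition. -/
def PSCond (φ : X → ℝ) : Prop :=
  ∀ x : ℕ → X, (∃ M : ℝ, ∀ n, |φ (x n)| ≤ M) →
    Tendsto (fun n => mSlope φ (x n)) atTop (𝓝 0) →
    ∃ z : X, ∃ s : ℕ → ℕ, StrictMono s ∧ Tendsto (fun n => x (s n)) atTop (𝓝 z)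

/-- duality map F(x*). -/
def dualityMap (xs : X →L[ℝ] ℝ) : Set X :=
  {x | xs x = ‖xs‖ ^ 2 ∧ ‖x‖ ^ 2 = ‖xs‖ ^ 2}

/-- `∇φ(x) = F(∂φ(x))`. -/
def clarkeGrad (φ : X → ℝ) (x : X) : Set X :=
  ⋃ xs ∈ clarkeSubdiff φ x, dualityMap xs

/-- normal cone to a convex set. -/
def normalCone (C : Set X) (x : X) : Set (X →L[ℝ] ℝ) :=
  {xs | ∀ z ∈ C, xs (z - x) ≤ 0}

/-- `∂φ` outwardly directed on `∂C`. -/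
def OutwardlyDirected (φ : X → ℝ) (C : Set X) : Prop :=
  ∀ x ∈ frontier C, ∀ xs ∈ clarkeSubdiff φ x, -xs ∈ normalCone C x → xs = 0

/-- Schauder invariance condition `(I - ∇φ)(C) ⊆ C`. -/
def SchauderInv (φ : X → ℝ) (C : Set X) : Prop :=
  ∀ x ∈ C, ∀ w ∈ clarkeGrad φ x, x - w ∈ C

/-- Reflexivity of a normed space. -/
def ReflexiveSpace (X : Type*) [NormedAddCommGroup X] [NormedSpace ℝ X] : Prop :=
  Function.Surjective (NormedSpace.inclusionInDoubleDual ℝ X)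

/-- Locally Lipschitz on a set. -/
def LocLipOn {α β : Type*} [PseudoMetricSpace α] [PseudoMetricSpace β]
    (f : α → β) (s : Set α) : Prop :=
  ∀ x ∈ s, ∃ K : NNReal, ∃ t ∈ 𝓝[s] x, LipschitzOnWith K f t


section ClarkeCalculus

variable {φ : X → ℝ}

theorem exists_eventually_abs_clarkeQuotient_le (hφ : LocallyLipschitz φ) (x : X) :
    ∃ K : ℝ, 0 ≤ K ∧ ∀ᶠ z in 𝓝 x, ∀ h : X, ∀ᶠ p : X × ℝ in 𝓝 z ×ˢ 𝓝[>] (0 : ℝ),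
      |(φ (p.1 + p.2 • h) - φ p.1) / p.2| ≤ K * ‖h‖ := by
  obtain ⟨K, t, ht, hK⟩ := hφ x
  refine ⟨K, K.2, ?_⟩
  filter_upwards [eventually_eventually_nhds.2 ht] with z hz h
  have hshift : Tendsto (fun p : X × ℝ => p.1 + p.2 • h) (𝓝 z ×ˢ 𝓝[>] (0 : ℝ)) (𝓝 z) := by
    have hc : Continuous fun p : X × ℝ => p.1 + p.2 • h := by fun_prop
    have hlim := hc.tendsto (z, 0)
    rw [nhds_prod_eq] at hlim
    simp only [zero_smul, add_zero] at hlim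
    exact hlim.mono_left (prod_mono le_rfl nhdsWithin_le_nhds)
  have hpos : ∀ᶠ p : X × ℝ in 𝓝 z ×ˢ 𝓝[>] (0 : ℝ), 0 < p.2 :=
    tendsto_snd.eventually self_mem_nhdsWithin
  filter_upwards [hshift.eventually hz, tendsto_fst.eventually hz, hpos] with p h1 h2 h3
  rw [abs_div, abs_of_pos h3, div_le_iff₀ h3]
  have hlip := hK.dist_le_mul _ h1 _ h2
  rw [Real.dist_eq, dist_eq_norm, add_sub_cancel_left, norm_smul, Real.norm_eq_abs,
    abs_of_pos h3] at hlip
  linarith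

theorem clarkeDeriv_le_of_eventually_le (hφ : LocallyLipschitz φ) {x h : X} {c : ℝ}
    (hc : ∀ᶠ p : X × ℝ in 𝓝 x ×ˢ 𝓝[>] (0 : ℝ), (φ (p.1 + p.2 • h) - φ p.1) / p.2 ≤ c) :
    clarkeDeriv φ x h ≤ c := by
  obtain ⟨K, -, hK⟩ := exists_eventually_abs_clarkeQuotient_le hφ x
  refine limsup_le_of_le ?_ hc
  refine IsCoboundedUnder.of_frequently_ge (a := -(K * ‖h‖)) (Eventually.frequently ?_)
  filter_upwards [hK.self_of_nhds h] with p hp using (abs_le.1 hp).1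

theorem eventually_lt_of_clarkeDeriv_lt (hφ : LocallyLipschitz φ) {x h : X} {c : ℝ}
    (hc : clarkeDeriv φ x h < c) :
    ∀ᶠ p : X × ℝ in 𝓝 x ×ˢ 𝓝[>] (0 : ℝ), (φ (p.1 + p.2 • h) - φ p.1) / p.2 < c := by
  obtain ⟨K, -, hK⟩ := exists_eventually_abs_clarkeQuotient_le hφ x
  refine eventually_lt_of_limsup_lt hc ?_
  refine isBoundedUnder_of_eventually_le (a := K * ‖h‖) ?_
  filter_upwards [hK.self_of_nhds h] with p hp using (abs_le.1 hp).2

theorem exists_eventually_clarkeDeriv_le (hφ : LocallyLipschitz φ) (x : X) :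
    ∃ K : ℝ, 0 ≤ K ∧ ∀ᶠ z in 𝓝 x, ∀ h : X, clarkeDeriv φ z h ≤ K * ‖h‖ := by
  obtain ⟨K, hK0, hK⟩ := exists_eventually_abs_clarkeQuotient_le hφ x
  refine ⟨K, hK0, ?_⟩
  filter_upwards [hK] with z hz h
  refine clarkeDeriv_le_of_eventually_le hφ ?_
  filter_upwards [hz h] with p hp using (abs_le.1 hp).2

theorem upperSemicontinuous_clarkeDeriv (hφ : LocallyLipschitz φ) (h : X) :
    UpperSemicontinuous fun x => clarkeDeriv φ x h := by
  intro x c hc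
  obtain ⟨d, hd, hdc⟩ := exists_between hc
  obtain ⟨u, hu, v, hv, huv⟩ :=
    eventually_prod_iff.1 (eventually_lt_of_clarkeDeriv_lt hφ hd)
  filter_upwards [eventually_eventually_nhds.2 hu] with z hz
  refine (clarkeDeriv_le_of_eventually_le hφ ?_).trans_lt hdc
  filter_upwards [hz.prod_mk hv] with p hp using (huv hp.1 hp.2).le

theorem clarkeDeriv_add_le (hφ : LocallyLipschitz φ) (x h k : X) :
    clarkeDeriv φ x (h + k) ≤ clarkeDeriv φ x h + clarkeDeriv φ x k := by
  refine le_of_forall_pos_le_add fun ε hε => clarkeDeriv_le_of_eventually_le hφ ?_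
  have hh := eventually_lt_of_clarkeDeriv_lt hφ
    (show clarkeDeriv φ x h < clarkeDeriv φ x h + ε / 2 by linarith)
  have hk := eventually_lt_of_clarkeDeriv_lt hφ
    (show clarkeDeriv φ x k < clarkeDeriv φ x k + ε / 2 by linarith)
  have hshift : Tendsto (fun p : X × ℝ => (p.1 + p.2 • h, p.2))
      (𝓝 x ×ˢ 𝓝[>] (0 : ℝ)) (𝓝 x ×ˢ 𝓝[>] (0 : ℝ)) := by
    refine Tendsto.prodMk ?_ tendsto_snd
    have hc : Continuous fun p : X × ℝ => p.1 + p.2 • h := by fun_prop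
    have hlim := hc.tendsto (x, 0)
    rw [nhds_prod_eq] at hlim
    simp only [zero_smul, add_zero] at hlim
    exact hlim.mono_left (prod_mono le_rfl nhdsWithin_le_nhds)
  filter_upwards [hh, hshift.eventually hk] with p h1 h2
  have hsplit : (φ (p.1 + p.2 • (h + k)) - φ p.1) / p.2 =
      (φ (p.1 + p.2 • h + p.2 • k) - φ (p.1 + p.2 • h)) / p.2 +
        (φ (p.1 + p.2 • h) - φ p.1) / p.2 := by
    rw [smul_add, add_assoc]; ring
  rw [hsplit]
  linarith

theorem clarkeDeriv_smul_le (hφ : LocallyLipschitz φ) (x h : X) {c : ℝ} (hc : 0 < c) :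
    clarkeDeriv φ x (c • h) ≤ c * clarkeDeriv φ x h := by
  refine le_of_forall_pos_le_add fun ε hε => clarkeDeriv_le_of_eventually_le hφ ?_
  have hh := eventually_lt_of_clarkeDeriv_lt hφ
    (show clarkeDeriv φ x h < clarkeDeriv φ x h + ε / c by
      have := div_pos hε hc
      linarith)
  have hscale : Tendsto (fun t : ℝ => t * c) (𝓝[>] 0) (𝓝[>] 0) := by
    refine tendsto_nhdsWithin_iff.2 ⟨?_, ?_⟩
    · have hlim := (continuous_mul_const c).tendsto 0
      rw [zero_mul] at hlim
      exact hlim.mono_left nhdsWithin_le_nhds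
    · filter_upwards [self_mem_nhdsWithin] with t ht using mul_pos ht hc
  filter_upwards [(tendsto_fst.prodMk (hscale.comp tendsto_snd)).eventually hh] with p hp
  simp only [Function.comp_apply, mul_smul] at hp
  have hquot : (φ (p.1 + p.2 • c • h) - φ p.1) / p.2 =
      c * ((φ (p.1 + p.2 • c • h) - φ p.1) / (p.2 * c)) := by
    field_simp
  rw [hquot]
  have hmul := mul_le_mul_of_nonneg_left hp.le hc.le
  rwa [mul_add, mul_div_cancel₀ _ hc.ne'] at hmul

theorem clarkeDeriv_smul (hφ : LocallyLipschitz φ) (x h : X) {c : ℝ} (hc : 0 < c) :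
    clarkeDeriv φ x (c • h) = c * clarkeDeriv φ x h := by
  refine le_antisymm (clarkeDeriv_smul_le hφ x h hc) ?_
  have hinv := clarkeDeriv_smul_le hφ x (c • h) (inv_pos.2 hc)
  rw [inv_smul_smul₀ hc.ne'] at hinv
  rwa [← le_inv_mul_iff₀ hc]

theorem clarkeSubdiff_nonempty (hφ : LocallyLipschitz φ) (x : X) :
    (clarkeSubdiff φ x).Nonempty := by
  obtain ⟨K, -, hK⟩ := exists_eventually_clarkeDeriv_le hφ x
  have hzero : 0 ≤ clarkeDeriv φ x 0 := by
    by_contra! hneg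
    obtain ⟨p, hp⟩ := (eventually_lt_of_clarkeDeriv_lt hφ hneg).exists
    simp at hp
  obtain ⟨g, -, hg⟩ := exists_extension_of_le_sublinear (⟨⊥, 0⟩ : X →ₗ.[ℝ] ℝ)
    (clarkeDeriv φ x) (fun c hc h => clarkeDeriv_smul hφ x h hc)
    (clarkeDeriv_add_le hφ x) (by
      rintro ⟨y, hy⟩
      obtain rfl := (Submodule.mem_bot ℝ).1 hy
      exact hzero)
  refine ⟨g.mkContinuous K fun h => abs_le.2 ⟨?_, ?_⟩, hg⟩
  · have hneg := (hg (-h)).trans (hK.self_of_nhds (-h))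
    rw [map_neg, norm_neg] at hneg
    linarith
  · exact (hg h).trans (hK.self_of_nhds h)

theorem exists_eventually_norm_clarkeSubdiff_le (hφ : LocallyLipschitz φ) (x : X) :
    ∃ K : ℝ, ∀ᶠ z in 𝓝 x, ∀ f ∈ clarkeSubdiff φ z, ‖f‖ ≤ K := by
  obtain ⟨K, hK0, hK⟩ := exists_eventually_clarkeDeriv_le hφ x
  refine ⟨K, ?_⟩
  filter_upwards [hK] with z hz f hf
  refine f.opNorm_le_bound hK0 fun h => abs_le.2 ⟨?_, (hf h).trans (hz h)⟩
  have hneg := (hf (-h)).trans (hz (-h))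
  rw [map_neg, norm_neg] at hneg
  linarith

end ClarkeCalculus

/-- Value of the supremum in the definition of `mCSlope` at a functional `f`. -/
def slopeAlong (C : Set X) (x : X) (f : X →L[ℝ] ℝ) : ℝ :=
  sSup {s | ∃ y ∈ C, ‖x - y‖ < 1 ∧ s = f (x - y)}

theorem le_slopeAlong {C : Set X} {x y : X} (f : X →L[ℝ] ℝ) (hy : y ∈ C) (hxy : ‖x - y‖ < 1) :
    f (x - y) ≤ slopeAlong C x f := by
  refine le_csSup ⟨‖f‖, ?_⟩ ⟨y, hy, hxy, rfl⟩
  rintro _ ⟨z, -, hz, rfl⟩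
  exact (le_abs_self _).trans ((f.le_opNorm _).trans (mul_le_of_le_one_right (norm_nonneg _) hz.le))

theorem slopeAlong_le {C : Set X} {x : X} (hx : x ∈ C) {f : X →L[ℝ] ℝ} {c : ℝ}
    (h : ∀ y ∈ C, ‖x - y‖ < 1 → f (x - y) ≤ c) : slopeAlong C x f ≤ c := by
  refine csSup_le ⟨f (x - x), x, hx, by simp, rfl⟩ ?_
  rintro _ ⟨y, hy, hxy, rfl⟩
  exact h y hy hxy

theorem slopeAlong_nonneg {C : Set X} {x : X} (hx : x ∈ C) (f : X →L[ℝ] ℝ) :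
    0 ≤ slopeAlong C x f := by
  simpa using le_slopeAlong f hx (show ‖x - x‖ < 1 by simp)

theorem mCSlope_eq_sInf_image (φ : X → ℝ) (C : Set X) (x : X) :
    mCSlope φ C x = sInf (slopeAlong C x '' clarkeSubdiff φ x) := by
  unfold mCSlope slopeAlong
  congr 1
  ext r
  simp only [mem_ofPred_eq, mem_image, eq_comm]

theorem mCSlope_le {φ : X → ℝ} {C : Set X} {x : X} (hx : x ∈ C) {f : X →L[ℝ] ℝ}
    (hf : f ∈ clarkeSubdiff φ x) : mCSlope φ C x ≤ slopeAlong C x f := by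
  rw [mCSlope_eq_sInf_image]
  refine csInf_le ⟨0, ?_⟩ (mem_image_of_mem _ hf)
  rintro _ ⟨g, -, rfl⟩
  exact slopeAlong_nonneg hx g

/-- Sublevel bounds on the slope pass to weak-* limits of Clarke subgradients. -/
theorem exists_mem_clarkeSubdiff_slopeAlong_le {φ : X → ℝ} (hφ : LocallyLipschitz φ) {C : Set X}
    {x : X} (hx : x ∈ C) {ι : Type*} {l : Filter ι} [l.NeBot] {z : ι → X}
    {f : ι → X →L[ℝ] ℝ} {a : ι → ℝ} {c : ℝ} (hz : Tendsto z l (𝓝 x))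
    (hf : ∀ᶠ i in l, f i ∈ clarkeSubdiff φ (z i))
    (hfa : ∀ᶠ i in l, slopeAlong C (z i) (f i) ≤ a i) (ha : Tendsto a l (𝓝 c)) :
    ∃ g ∈ clarkeSubdiff φ x, slopeAlong C x g ≤ c := by
  obtain ⟨K, hK⟩ := exists_eventually_norm_clarkeSubdiff_le hφ x
  have hbound : ∀ᶠ i in l, ‖f i‖ ≤ K := by
    filter_upwards [hz.eventually hK, hf] with i h1 h2 using h1 _ h2
  let U : Ultrafilter ι := Ultrafilter.of l
  have hU : (U : Filter ι) ≤ l := Ultrafilter.of_le l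
  obtain ⟨g, -, hg⟩ := (WeakDual.isCompact_closedBall (𝕜 := ℝ) (E := X) 0 K).ultrafilter_le_nhds
    (U.map fun i => StrongDual.toWeakDual (f i)) (by
      have hball : ∀ᶠ i in (U : Filter ι), StrongDual.toWeakDual (f i) ∈
          WeakDual.toStrongDual ⁻¹' Metric.closedBall (0 : StrongDual ℝ X) K :=
        hU (hbound.mono fun i hi => mem_closedBall_zero_iff.2 hi)
      exact le_principal_iff.2 hball)
  have hpt : ∀ h : X, Tendsto (fun i => f i h) U (𝓝 (WeakDual.toStrongDual g h)) := fun h =>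
    (WeakDual.eval_continuous h).continuousAt.tendsto.comp hg
  refine ⟨WeakDual.toStrongDual g, fun h => ?_, slopeAlong_le hx fun y hy hxy => ?_⟩
  · refine le_of_forall_gt_imp_ge_of_dense fun b hb => le_of_tendsto (hpt h) ?_
    filter_upwards [hU hf, hU (hz.eventually (upperSemicontinuous_clarkeDeriv hφ h x b hb))]
      with i h1 h2 using (h1 h).trans h2.le
  · have hsmall : Tendsto (fun i => f i (z i - x)) U (𝓝 0) := by
      refine squeeze_zero_norm' (a := fun i => K * ‖z i - x‖) ?_ ?_
      · filter_upwards [hU hbound] with i hi using (f i).le_of_opNorm_le hi _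
      · have hnorm := ((hz.mono_left hU).sub_const x).norm.const_mul K
        simpa using hnorm
    have hlim := hsmall.add (hpt (x - y))
    rw [zero_add] at hlim
    refine le_of_tendsto_of_tendsto hlim (ha.mono_left hU) ?_
    have hnear : ∀ᶠ i in l, ‖z i - y‖ < 1 := (hz.sub_const y).norm.eventually_lt_const hxy
    filter_upwards [hU hnear, hU hfa] with i h1 h2
    rw [← map_add, sub_add_sub_cancel]
    exact (le_slopeAlong (f i) hy h1).trans h2

theorem exists_mem_clarkeSubdiff_mCSlope_eq {φ : X → ℝ} (hφ : LocallyLipschitz φ) {C : Set X}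
    {x : X} (hx : x ∈ C) : ∃ g ∈ clarkeSubdiff φ x, mCSlope φ C x = slopeAlong C x g := by
  have happrox : ∀ n : ℕ, ∃ f ∈ clarkeSubdiff φ x,
      slopeAlong C x f < mCSlope φ C x + 1 / ((n : ℝ) + 1) := fun n => by
    have hlt : sInf (slopeAlong C x '' clarkeSubdiff φ x) <
        mCSlope φ C x + 1 / ((n : ℝ) + 1) := by
      rw [← mCSlope_eq_sInf_image]
      exact lt_add_of_pos_right _ Nat.one_div_pos_of_nat
    obtain ⟨_, ⟨f, hf, rfl⟩, hfn⟩ :=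
      exists_lt_of_csInf_lt ((clarkeSubdiff_nonempty hφ x).image _) hlt
    exact ⟨f, hf, hfn⟩
  choose f hf hfn using happrox
  obtain ⟨g, hg, hgle⟩ := exists_mem_clarkeSubdiff_slopeAlong_le hφ hx
    (l := atTop) (z := fun _ : ℕ => x) (c := mCSlope φ C x) tendsto_const_nhds
    (Eventually.of_forall hf) (Eventually.of_forall fun n => (hfn n).le)
    (by simpa using tendsto_one_div_add_atTop_nhds_zero_nat.const_add (mCSlope φ C x))
  exact ⟨g, hg, le_antisymm (mCSlope_le hx hg) hgle⟩

theorem lowerSemicontinuousOn_mCSlope {φ : X → ℝ} (hφ : LocallyLipschitz φ) (C : Set X) :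
    LowerSemicontinuousOn (mCSlope φ C) C := by
  intro x hx c hc
  by_contra hnot
  have hfreq : ∃ᶠ z in 𝓝[C] x, z ∈ C ∧ mCSlope φ C z ≤ c := by
    refine ((not_eventually.1 hnot).and_eventually self_mem_nhdsWithin).mono ?_
    rintro z ⟨hzc, hzC⟩
    exact ⟨hzC, not_lt.1 hzc⟩
  have hmin : ∀ z : X, ∃ f : X →L[ℝ] ℝ, z ∈ C →
      f ∈ clarkeSubdiff φ z ∧ mCSlope φ C z = slopeAlong C z f := fun z => by
    by_cases hzC : z ∈ C
    · obtain ⟨f, hf⟩ := exists_mem_clarkeSubdiff_mCSlope_eq hφ hzC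
      exact ⟨f, fun _ => hf⟩
    · exact ⟨0, fun h => absurd h hzC⟩
  choose f hf using hmin
  have hne : (𝓝[C] x ⊓ 𝓟 {z | z ∈ C ∧ mCSlope φ C z ≤ c}).NeBot :=
    frequently_mem_iff_neBot.1 hfreq
  have hmem : ∀ᶠ z in 𝓝[C] x ⊓ 𝓟 {z | z ∈ C ∧ mCSlope φ C z ≤ c},
      z ∈ C ∧ mCSlope φ C z ≤ c := mem_inf_of_right (mem_principal_self _)
  obtain ⟨g, hg, hgc⟩ := exists_mem_clarkeSubdiff_slopeAlong_le hφ hx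
    (z := fun z => z) (f := f) (a := fun _ => c)
    (tendsto_id.mono_left (inf_le_left.trans nhdsWithin_le_nhds))
    (hmem.mono fun z hz => (hf z hz.1).1)
    (hmem.mono fun z hz => (hf z hz.1).2 ▸ hz.2) tendsto_const_nhds
  exact (hc.trans_le (mCSlope_le hx hg)).not_ge hgc

/-- Fact from [14]: for each `x ∈ C` the infimum defining `m_C(x)` is attained at some
`x* ∈ ∂φ(x)`, and `x ↦ m_C(x)` is lower semicontinuous on `C`. -/
theorem mC_attained_and_lsc
    {X : Type*} [NormedAddCommGroup X] [NormedSpace ℝ X]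
    (hrefl : ReflexiveSpace X)
    (C : Set X) (hCnt : C.Nontrivial) (hCcl : IsClosed C) (hCconv : Convex ℝ C)
    (φ : X → ℝ) (hφ : LocallyLipschitz φ) :
    (∀ x ∈ C, ∃ xs ∈ clarkeSubdiff φ x,
      mCSlope φ C x = sSup {s | ∃ y ∈ C, ‖x - y‖ < 1 ∧ s = xs (x - y)}) ∧
    LowerSemicontinuousOn (mCSlope φ C) C := by
  exact ⟨fun _ hx => exists_mem_clarkeSubdiff_mCSlope_eq hφ hx,
    lowerSemicontinuousOn_mCSlope hφ C⟩

end
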